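/- Let T be a decision tree of dimension n, let y be a partial instance of dimension n with set of defined features S = {i : y[i] ≠ ⊥}, and let R(T), the extended feature set F, natural/artificial leaves, and the extension v ↦ v* be as defined. Then for every partial instance v over F with v ⊆ y* (i.e., v is subsumed by the extension y* of y), the number of completions of v that reach a true artificial leaf equals the number that reach a false artificial leaf: |{w ∈ Comp(v) : R(T)↓w ∈ 𝒜_t}| = |{w ∈ Comp(v) : R(T)↓w ∈ 𝒜_f}|. -/

import Mathlib

/-- Binary decision trees whose internal nodes are labeled by features in `α`. -/
inductive DT (α : Type) : Type where
  | leaf (b : Bool)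
  | node (i : α) (t0 t1 : DT α)

namespace DT

/-- Evaluation of a decision tree on an instance. -/
def eval {α : Type} : DT α → (α → Bool) → Bool
  | leaf b, _ => b
  | node i t0 t1, z => if z i then eval t1 z else eval t0 z

/-- The set of features appearing in a tree. -/
def vars {α : Type} [DecidableEq α] : DT α → Finset α
  | leaf _ => ∅
  | node i t0 t1 => insert i (vars t0 ∪ vars t1)

/-- No feature appears twice on any root-to-leaf path. -/
def ReadOnce {α : Type} [DecidableEq α] : DT α → Prop
  | leaf _ => True
  | node i t0 t1 => i ∉ vars t0 ∧ i ∉ vars t1 ∧ ReadOnce t0 ∧ ReadOnce t1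

/-- The number of internal nodes of a tree. -/
def internals {α : Type} : DT α → ℕ
  | leaf _ => 0
  | node _ t0 t1 => 1 + internals t0 + internals t1

/-- The total number of nodes (internal nodes and leaves) of a tree. -/
def size {α : Type} : DT α → ℕ
  | leaf _ => 1
  | node _ t0 t1 => 1 + size t0 + size t1

/-- The label sequences of all root-to-leaf paths of a tree. -/
def paths {α : Type} : DT α → List (List α)
  | leaf _ => [[]]
  | node i t0 t1 => (paths t0 ++ paths t1).map (fun p => i :: p)

end DT

/-- A partial instance `y` is subsumed by a partial instance `y'`. -/
def Subsumes {α : Type} (y y' : α → Option Bool) : Prop :=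
  ∀ i, y i ≠ none → y i = y' i

/-- The set of completions of a partial instance `y`. -/
def Comp {α : Type} [Fintype α] [DecidableEq α] (y : α → Option Bool) :
    Finset (α → Bool) :=
  Finset.univ.filter (fun z => ∀ i, ∀ b : Bool, y i = some b → z i = b)

/-- The number of undefined components of a partial instance. -/
def numUndef {α : Type} [Fintype α] [DecidableEq α] (y : α → Option Bool) : ℕ :=
  (Finset.univ.filter (fun i => y i = none)).card

/-- The extended feature set: the original features `1, …, n` together with
a fresh duplicate feature `i'` for each feature `i` outside the set
`S = {i : y i ≠ ⊥}` of defined features of `y`. -/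
abbrev ExtF (n : ℕ) (y : Fin n → Option Bool) : Type :=
  Fin n ⊕ {i : Fin n // y i = none}

/-- The recursive transformation `R` of a decision tree: nodes labeled by a
feature `i ∈ S` are kept as is; a node labeled `i ∉ S` with subtrees `T₀, T₁`
is replaced by a node labeled `i` whose `0`-child is a node labeled `i'` with
`0`-subtree `R(T₀)` and `1`-child a fresh false leaf, and whose `1`-child is
a node labeled `i'` with `0`-child a fresh true leaf and `1`-subtree `R(T₁)`. -/
def Rmap {n : ℕ} (y : Fin n → Option Bool) : DT (Fin n) → DT (ExtF n y)
  | .leaf b => .leaf b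
  | .node i t0 t1 =>
    if h : y i = none then
      .node (.inl i)
        (.node (.inr ⟨i, h⟩) (Rmap y t0) (.leaf false))
        (.node (.inr ⟨i, h⟩) (.leaf true) (Rmap y t1))
    else
      .node (.inl i) (Rmap y t0) (Rmap y t1)

/-- Classification of the leaves of `R(T)`: natural true/false leaves (copies
of leaves of `T`) and artificial true/false leaves (the fresh leaves
introduced for features outside `S`). -/
inductive LeafKind : Type where
  | natT | natF | artT | artF
deriving DecidableEq

/-- The kind of the leaf of `R(T)` reached by an instance `w` over the
extended feature set. -/
def Rleaf {n : ℕ} (y : Fin n → Option Bool) :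
    DT (Fin n) → (ExtF n y → Bool) → LeafKind
  | .leaf b, _ => if b then .natT else .natF
  | .node i t0 t1, w =>
    if h : y i = none then
      if w (.inl i) then
        (if w (.inr ⟨i, h⟩) then Rleaf y t1 w else .artT)
      else
        (if w (.inr ⟨i, h⟩) then .artF else Rleaf y t0 w)
    else
      if w (.inl i) then Rleaf y t1 w else Rleaf y t0 w

/-- The extension `v*` of a partial instance `v` of dimension `n` to the
extended feature set: it agrees with `v` on the original features and is
undefined on every duplicate feature. -/
def extPI {n : ℕ} (y : Fin n → Option Bool) (v : Fin n → Option Bool) :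
    ExtF n y → Option Bool :=
  Sum.elim v (fun _ => none)

/-- `(T, y)` is strongly balanced with parameter `u`: strictly more than half
of the completions of `y` are accepted by `T`, and on every root-to-leaf path
of `T` with label sequence `s₁, s₂, …`, the feature `s_j` is undefined in `y`
exactly when `j ≤ u` (0-indexed: when `j < u`). -/
def StronglyBalanced {n : ℕ} (T : DT (Fin n)) (y : Fin n → Option Bool)
    (u : ℕ) : Prop :=
  2 ^ numUndef y < 2 * ((Comp y).filter (fun z => T.eval z = true)).card ∧
  ∀ p ∈ T.paths, ∀ (j : ℕ) (h : j < p.length),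
    (y (p.get ⟨j, h⟩) = none ↔ j < u)

/-- Exchange the value of each feature undefined in `y` with that of its duplicate. -/
def swapDup {n : ℕ} (y : Fin n → Option Bool) (w : ExtF n y → Bool) : ExtF n y → Bool :=
  Sum.elim (fun i => if h : y i = none then w (.inr ⟨i, h⟩) else w (.inl i))
    (fun i => w (.inl i.1))

theorem swapDup_swapDup {n : ℕ} (y : Fin n → Option Bool) (w : ExtF n y → Bool) :
    swapDup y (swapDup y w) = w := by
  funext i
  rcases i with i | ⟨i, h⟩
  · by_cases h : y i = none <;> simp [swapDup, h]
  · simp [swapDup, h]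

/-- Exchange the two kinds of artificial leaves. -/
def LeafKind.swapArt : LeafKind → LeafKind
  | natT => natT
  | natF => natF
  | artT => artF
  | artF => artT

theorem Rleaf_swapDup {n : ℕ} (y : Fin n → Option Bool) (T : DT (Fin n))
    (w : ExtF n y → Bool) : Rleaf y T (swapDup y w) = (Rleaf y T w).swapArt := by
  induction T with
  | leaf b => cases b <;> rfl
  | node i t0 t1 ih0 ih1 =>
    by_cases h : y i = none
    · have hl : swapDup y w (.inl i) = w (.inr ⟨i, h⟩) := by simp [swapDup, h]
      have hr : swapDup y w (.inr ⟨i, h⟩) = w (.inl i) := rfl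
      simp only [Rleaf, h, dif_pos, hl, hr]
      cases w (.inl i) <;> cases w (.inr ⟨i, h⟩) <;> simp [ih0, ih1, LeafKind.swapArt]
    · have hl : swapDup y w (.inl i) = w (.inl i) := by simp [swapDup, h]
      simp only [Rleaf, h, dif_neg, not_false_eq_true, hl]
      cases w (.inl i) <;> simp [ih0, ih1]

theorem swapDup_mem_Comp {n : ℕ} {y : Fin n → Option Bool} {v : ExtF n y → Option Bool}
    (hv : Subsumes v (extPI y y)) {w : ExtF n y → Bool} (hw : w ∈ Comp v) :
    swapDup y w ∈ Comp v := by
  simp only [Comp, Finset.mem_filter, Finset.mem_univ, true_and] at hw ⊢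
  intro i b hb
  have hy : extPI y y i = some b := by rw [← hv i (by simp [hb]), hb]
  rcases i with i | i
  · have hi : y i = some b := hy
    simpa [swapDup, hi] using hw _ b hb
  · simp [extPI] at hy

/-- For every partial instance `v` over the extended feature set subsumed by
`y*`, the completions of `v` reaching a true artificial leaf of `R(T)` and
those reaching a false artificial leaf are equinumerous. -/
theorem stmt13 {n : ℕ} (T : DT (Fin n)) (hT : T.ReadOnce)
    (y : Fin n → Option Bool)
    (v : ExtF n y → Option Bool) (hv : Subsumes v (extPI y y)) :
    ((Comp v).filter (fun w => Rleaf y T w = LeafKind.artT)).card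
      = ((Comp v).filter (fun w => Rleaf y T w = LeafKind.artF)).card := by
  refine Finset.card_bij' (fun w _ => swapDup y w) (fun w _ => swapDup y w) ?_ ?_
    (fun w _ => swapDup_swapDup y w) (fun w _ => swapDup_swapDup y w)
  all_goals
    intro w hw
    rw [Finset.mem_filter] at hw ⊢
    exact ⟨swapDup_mem_Comp hv hw.1, by rw [Rleaf_swapDup, hw.2]; rfl⟩
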